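/- Let G be a finite graph with nonnegative vertex weights, C_G(i) = J_G − J_{G∖{i}} the cavity of node i. If C_G(i) > 0 then every maximum weight independent set of G contains i; if W_i − Σ_l C_{G∖{i,i_1,…,i_{l−1}}}(i_l) < 0 then no maximum weight independent set contains i. -/

import Mathlib

variable {V : Type*} [DecidableEq V]

/-- `cavSum C H [i₁,…,i_d] = Σ_l C_{H∖{i₁,…,i_{l−1}}}(i_l)`. -/
def cavSum (C : Finset V → V → ℝ) : Finset V → List V → ℝ
  | _, [] => 0
  | H, a :: L => C H a + cavSum C (H.erase a) L

open Classical in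
/-- `maxWeight G W H` is the maximum weight `J_H` of an independent set of the
induced subgraph of `G` on `H`. -/
noncomputable def maxWeight (G : SimpleGraph V) (W : V → ℝ) (H : Finset V) : ℝ :=
  (H.powerset.filter (fun S => ∀ a ∈ S, ∀ b ∈ S, ¬ G.Adj a b)).sup'
    ⟨∅, by simp⟩ (fun S => ∑ v ∈ S, W v)

theorem cavSum_sub_eq (J : Finset V → ℝ) (H : Finset V) (L : List V) :
    cavSum (fun H j => J H - J (H.erase j)) H L = J H - J (L.foldl Finset.erase H) := by
  induction L generalizing H with
  | nil => simp [cavSum]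
  | cons a L ih => simp [cavSum, ih]

theorem mem_foldl_erase (L : List V) (H : Finset V) (v : V) :
    v ∈ L.foldl Finset.erase H ↔ v ∈ H ∧ v ∉ L := by
  induction L generalizing H with
  | nil => simp
  | cons a L ih =>
    simp only [List.foldl_cons, ih, Finset.mem_erase, List.mem_cons]
    tauto

theorem sum_le_maxWeight {U : Type*} (G : SimpleGraph U) (W : U → ℝ) {H S : Finset U}
    (hS : S ⊆ H) (hind : ∀ a ∈ S, ∀ b ∈ S, ¬ G.Adj a b) : ∑ v ∈ S, W v ≤ maxWeight G W H := by
  refine Finset.le_sup' (fun S => ∑ v ∈ S, W v) ?_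
  simp only [Finset.mem_filter]
  exact ⟨Finset.mem_powerset.2 hS, hind⟩

theorem maxWeight_mono {U : Type*} (G : SimpleGraph U) (W : U → ℝ) {H K : Finset U}
    (h : H ⊆ K) : maxWeight G W H ≤ maxWeight G W K := by
  refine Finset.sup'_le _ _ fun S hS => ?_
  simp only [Finset.mem_filter] at hS
  obtain ⟨hS, hind⟩ := hS
  exact sum_le_maxWeight G W ((Finset.mem_powerset.1 hS).trans h) hind

/-- If the cavity `C_G(i) = J_G − J_{G∖{i}}` is positive, every maximum weight
independent set contains `i`; if `W_i − Σ_l C_{G∖{i,i₁,…,i_{l−1}}}(i_l) < 0`,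
no maximum weight independent set contains `i`. -/
theorem cavity_determines_membership [Fintype V] (G : SimpleGraph V) (W : V → ℝ)
    (hW : ∀ v, 0 ≤ W v) (i : V) (L : List V) (hnd : L.Nodup)
    (hL : ∀ v, v ∈ L ↔ G.Adj i v)
    (S : Finset V) (hind : ∀ a ∈ S, ∀ b ∈ S, ¬ G.Adj a b)
    (hopt : ∑ v ∈ S, W v = maxWeight G W Finset.univ) :
    (0 < maxWeight G W Finset.univ - maxWeight G W (Finset.univ.erase i) → i ∈ S) ∧
    (W i - cavSum (fun H j => maxWeight G W H - maxWeight G W (H.erase j))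
        (Finset.univ.erase i) L < 0 → i ∉ S) := by
  refine ⟨fun h => ?_, fun h hi => ?_⟩
  · by_contra hi
    have := sum_le_maxWeight G W
      (Finset.subset_erase.2 ⟨Finset.subset_univ S, hi⟩) hind
    linarith
  · rw [cavSum_sub_eq (maxWeight G W)] at h
    have hsub : S.erase i ⊆ L.foldl Finset.erase (Finset.univ.erase i) := by
      intro v hv
      obtain ⟨hvi, hvS⟩ := Finset.mem_erase.1 hv
      rw [mem_foldl_erase, hL]
      exact ⟨Finset.mem_erase.2 ⟨hvi, Finset.mem_univ v⟩, hind i hi v hvS⟩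
    have hle := sum_le_maxWeight G W hsub fun a ha b hb =>
      hind a (Finset.mem_of_mem_erase ha) b (Finset.mem_of_mem_erase hb)
    have hmono := maxWeight_mono G W (Finset.erase_subset i Finset.univ)
    have hsum := Finset.add_sum_erase S W hi
    linarith
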